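/- arXiv:2205.05347 — 3 statements merged into one kernel-verified Lean document; each statement's English description precedes it below -/
import Mathlib

section
/- For every natural number n, Q(−n) = (−1)^{n+1}·ι(Q(n)), where ι : ℤ[v^{±1}] → ℤ[v^{±1}] is the ring automorphism determined by v ↦ v^{−1} (Mathlib's LaurentPolynomial.invert). -/
open LaurentPolynomial

/-- For every natural number `n`, `Q (-n) = (-1)^(n+1) * ι (Q n)`, where `ι` is the
automorphism of `ℤ[v^{±1}]` determined by `v ↦ v⁻¹` (Mathlib's `LaurentPolynomial.invert`),
and `Q` is determined by `Q 0 = v⁻¹ - v`, `Q 1 = 1` and `Q (n+2) = v * Q (n+1) + v² * Q n`. -/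
theorem stmt_2 (Q : ℤ → LaurentPolynomial ℤ) (hQ0 : Q 0 = T (-1) - T 1) (hQ1 : Q 1 = 1)
    (hQrec : ∀ n : ℤ, Q (n + 2) = T 1 * Q (n + 1) + T 2 * Q n) :
    ∀ n : ℕ, Q (-(n : ℤ)) = (-1) ^ (n + 1) * LaurentPolynomial.invert (Q (n : ℤ)) := by
  have hab : (T (-1) : LaurentPolynomial ℤ) * T 1 = 1 := by rw [← T_add]; simp
  have h2 : (T 2 : LaurentPolynomial ℤ) = T 1 * T 1 := by rw [← T_add]; norm_num
  have hm2 : (T (-2) : LaurentPolynomial ℤ) = T (-1) * T (-1) := by rw [← T_add]; norm_num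
  have back : ∀ m : ℤ, Q m = T (-1) * T (-1) * Q (m + 2) - T (-1) * Q (m + 1) := by
    intro m
    rw [hQrec m, h2]
    linear_combination (-(T (-1) * Q (m + 1)) - (T (-1) * T 1 + 1) * Q m) * hab
  intro n
  induction n using Nat.twoStepInduction with
  | zero => simp [hQ0]
  | one =>
    have h := back (-1)
    norm_num [hQ0, hQ1] at h
    simp only [Nat.cast_one, hQ1, map_one]
    rw [h]
    linear_combination hab
  | more n ih1 ih2 =>
    have h := back (-((n + 2 : ℕ) : ℤ))
    have e1 : -((n + 2 : ℕ) : ℤ) + 2 = -(n : ℤ) := by push_cast; ring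
    have e2 : -((n + 2 : ℕ) : ℤ) + 1 = -((n + 1 : ℕ) : ℤ) := by push_cast; ring
    rw [e1, e2, ih1, ih2] at h
    have h' : invert (Q ((n + 2 : ℕ) : ℤ)) = T (-1) * invert (Q ((n + 1 : ℕ) : ℤ))
        + T (-1) * T (-1) * invert (Q (n : ℤ)) := by
      have := hQrec n
      push_cast
      rw [this]
      simp [hm2]
      ring
    rw [h, h']
    ring
end

section
/- Let p and q be odd integers, both different from 1 and −1. Then F(p+q+1) + F(p+1)·F(q+1) ≠ 0. -/
/-- If `p` and `q` are odd integers different from `1` and `-1`, then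
`F (p+q+1) + F (p+1) * F (q+1) ≠ 0`, where `F` is the two-sided Fibonacci sequence. -/
theorem stmt_6 (F : ℤ → ℤ) (hF0 : F 0 = 0) (hF1 : F 1 = 1)
    (hFrec : ∀ n : ℤ, F (n + 2) = F (n + 1) + F n)
    (p q : ℤ) (hp : Odd p) (hq : Odd q) (hp1 : p ≠ 1) (hp1' : p ≠ -1)
    (hq1 : q ≠ 1) (hq1' : q ≠ -1) :
    F (p + q + 1) + F (p + 1) * F (q + 1) ≠ 0 := by
  have rec' : ∀ a b c : ℤ, b = a + 1 → c = a + 2 → F c = F b + F a := by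
    rintro a b c rfl rfl
    exact hFrec a
  have hadd : ∀ q : ℤ, F (p + q + 1) = F (p + 1) * F (q + 1) + F p * F q ∧
      F (p + q + 2) = F (p + 1) * F (q + 2) + F p * F (q + 1) := by
    intro q
    induction q using Int.induction_on with
    | zero =>
      have h1 := rec' 0 1 2 (by norm_num) (by norm_num)
      have h2 := hFrec p
      simp only [add_zero, zero_add, h1, hF0, hF1, h2]
      constructor <;> ring
    | succ i ih =>
      obtain ⟨h1, h2⟩ := ih
      have e1 := rec' (p + i + 1) (p + i + 2) (p + (i + 1) + 2) (by ring) (by ring)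
      have e2 := rec' (i + 1) (i + 2) (i + 1 + 2) (by ring) (by ring)
      have e3 := rec' i (i + 1) (i + 2) (by ring) (by ring)
      rw [show p + ((i : ℤ) + 1) + 1 = p + i + 2 by ring, show (i : ℤ) + 1 + 1 = i + 2 by ring]
      refine ⟨h2, ?_⟩
      rw [e1, e2, h1, h2, e3]
      ring
    | pred i ih =>
      obtain ⟨h1, h2⟩ := ih
      have e1 := rec' (p + (-i - 1) + 1) (p + -i + 1) (p + -i + 2) (by ring) (by ring)
      have e2 := rec' (-i - 1) (-i) (-i + 1) (by ring) (by ring)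
      have e3 := rec' (-i) (-i + 1) (-i + 2) (by ring) (by ring)
      rw [show p + (-(i : ℤ) - 1) + 2 = p + -i + 1 by ring, show -(i : ℤ) - 1 + 1 = -i by ring,
        show -(i : ℤ) - 1 + 2 = -i + 1 by ring]
      refine ⟨?_, h1⟩
      have e4 : F (-i - 1) = F (-i + 1) - F (-i) := by linarith
      have e5 : F (p + (-i - 1) + 1) = F (p + -i + 2) - F (p + -i + 1) := by linarith
      rw [e5, h1, h2, e4, e3]
      ring
  have f2 := rec' 0 1 2 (by norm_num) (by norm_num)
  have f3 := rec' 1 2 3 (by norm_num) (by norm_num)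
  have f4 := rec' 2 3 4 (by norm_num) (by norm_num)
  have g1 := rec' (-1) 0 1 (by norm_num) (by norm_num)
  have g2 := rec' (-2) (-1) 0 (by norm_num) (by norm_num)
  have g3 := rec' (-3) (-2) (-1) (by norm_num) (by norm_num)
  have hpos : ∀ k : ℕ, 0 < F (2 * k + 3) ∧ F (2 * k + 3) < F (2 * k + 4) := by
    intro k
    induction k with
    | zero => norm_num; constructor <;> linarith
    | succ k ih =>
      have e1 := rec' (2 * k + 3) (2 * k + 4) (2 * (k + 1 : ℕ) + 3) (by ring) (by push_cast; ring)
      have e2 := rec' (2 * k + 4) (2 * (k + 1 : ℕ) + 3) (2 * (k + 1 : ℕ) + 4)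
        (by push_cast; ring) (by push_cast; ring)
      constructor <;> linarith
  have hneg : ∀ k : ℕ, 0 < F (-2 * k - 3) ∧ F (-2 * k - 2) < 0 ∧
      F (-2 * k - 3) ≤ -2 * F (-2 * k - 2) := by
    intro k
    induction k with
    | zero => norm_num; refine ⟨?_, ?_, ?_⟩ <;> linarith
    | succ k ih =>
      have e1 := rec' (-2 * (k + 1 : ℕ) - 2) (-2 * k - 3) (-2 * k - 2)
        (by push_cast; ring) (by push_cast; ring)
      have e2 := rec' (-2 * (k + 1 : ℕ) - 3) (-2 * (k + 1 : ℕ) - 2) (-2 * k - 3)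
        (by push_cast; ring) (by push_cast; ring)
      refine ⟨?_, ?_, ?_⟩ <;> linarith
  have key : ∀ r : ℤ, Odd r → r ≠ 1 → r ≠ -1 → 0 < F r ∧
      (F r < F (r + 1) ∨ (F (r + 1) < 0 ∧ F r ≤ -2 * F (r + 1))) := by
    rintro r ⟨m, rfl⟩ h1 h2
    rcases le_or_gt 1 m with h | h
    · have := hpos (m - 1).toNat
      rw [Int.toNat_of_nonneg (by omega), show 2 * (m - 1) + 3 = 2 * m + 1 by ring,
        show 2 * (m - 1) + 4 = 2 * m + 1 + 1 by ring] at this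
      exact ⟨this.1, Or.inl this.2⟩
    · have := hneg (-m - 2).toNat
      rw [Int.toNat_of_nonneg (by omega), show -2 * (-m - 2) - 3 = 2 * m + 1 by ring,
        show -2 * (-m - 2) - 2 = 2 * m + 1 + 1 by ring] at this
      exact ⟨this.1, Or.inr this.2⟩
  obtain ⟨a1, a2⟩ := key p hp hp1 hp1'
  obtain ⟨b1, b2⟩ := key q hq hq1 hq1'
  rw [(hadd q).1]
  generalize F p = a at *
  generalize F q = b at *
  generalize F (p + 1) = c at *
  generalize F (q + 1) = d at *
  have hab := mul_pos a1 b1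
  rcases a2 with a2 | ⟨a2, a3⟩ <;> rcases b2 with b2 | ⟨b2, b3⟩
  · have := mul_pos (a1.trans a2) (b1.trans b2)
    linarith
  · nlinarith
  · nlinarith
  · have := mul_pos_of_neg_of_neg a2 b2
    linarith
end

section
/- Let p, q be odd integers different from 1 and −1 with p + q ≥ 0, and let r > 0 be an integer. Then the braid β(p,q,−2r) ∈ B_{r+2} is quasipositive: it lies in the submonoid of B_{r+2} generated by the set of all conjugates w·a_i·w^{−1} with w ∈ B_{r+2} and 1 ≤ i ≤ r+1. -/
/-- The braid relators on generators `Fin m` (generator `i` is the paper's `a_{i+1}`):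
the braid relations `a_i a_{i+1} a_i = a_{i+1} a_i a_{i+1}` and the far commutation
relations `a_i a_j = a_j a_i` for `|i - j| ≥ 2`. -/
def braidRels (m : ℕ) : Set (FreeGroup (Fin m)) :=
  {x | ∃ i j : Fin m, (i : ℕ) + 1 = (j : ℕ) ∧
        x = FreeGroup.of i * FreeGroup.of j * FreeGroup.of i *
              (FreeGroup.of j * FreeGroup.of i * FreeGroup.of j)⁻¹} ∪
  {x | ∃ i j : Fin m, (i : ℕ) + 2 ≤ (j : ℕ) ∧
        x = FreeGroup.of i * FreeGroup.of j * (FreeGroup.of j * FreeGroup.of i)⁻¹}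

/-- The braid group on `n` strands, presented with generators `a_1, …, a_{n-1}`. -/
def BraidGroup (n : ℕ) : Type := PresentedGroup (braidRels (n - 1))

instance (n : ℕ) : Group (BraidGroup n) := by unfold BraidGroup; infer_instance

/-- The standard generator `a_i` (1-indexed, as in the paper) of the braid group on `n`
strands; defined to be `1` if `i` is out of range. -/
def braidGen (n i : ℕ) : BraidGroup n :=
  if h : 1 ≤ i ∧ i ≤ n - 1 then
    PresentedGroup.of (⟨i - 1, by omega⟩ : Fin (n - 1)) else 1

/-- `γ_r = a_3 a_4 ⋯ a_{|r|+1}` in the braid group on `m + 2` strands, where `m = |r|`. -/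
def gammaBraid (m : ℕ) : BraidGroup (m + 2) :=
  ((List.range (m - 1)).map (fun i => braidGen (m + 2) (i + 3))).prod

/-- `γ̄_r = a_{|r|+1} a_{|r|} ⋯ a_3` in the braid group on `m + 2` strands, where `m = |r|`. -/
def gammaBarBraid (m : ℕ) : BraidGroup (m + 2) :=
  ((List.range (m - 1)).map (fun i => braidGen (m + 2) (i + 3))).reverse.prod

/-- The braid `β(p,q,-2r)` on `|r| + 2` strands whose closure is the pretzel knot
`P(p,q,-2r)`. -/
def betaBraid (p q r : ℤ) : BraidGroup (r.natAbs + 2) :=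
  if 0 < r then
    braidGen (r.natAbs + 2) 1 ^ p * braidGen (r.natAbs + 2) 2 *
      braidGen (r.natAbs + 2) 1 ^ q * (gammaBraid r.natAbs)⁻¹ *
      braidGen (r.natAbs + 2) 2 * gammaBraid r.natAbs * gammaBarBraid r.natAbs
  else
    braidGen (r.natAbs + 2) 1 ^ p * (braidGen (r.natAbs + 2) 2)⁻¹ *
      braidGen (r.natAbs + 2) 1 ^ q * gammaBarBraid r.natAbs *
      (braidGen (r.natAbs + 2) 2)⁻¹ * (gammaBarBraid r.natAbs)⁻¹ *
      (gammaBraid r.natAbs)⁻¹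

/-- Let `p, q` be odd integers different from `1` and `-1` with `p + q ≥ 0`, and let
`r > 0` be an integer.  Then the braid `β(p,q,-2r)` is quasipositive: it lies in the
submonoid of the braid group on `r + 2` strands generated by all conjugates
`w * a_i * w⁻¹` of the standard generators. -/
theorem stmt_11 (p q r : ℤ) (hp : Odd p) (hq : Odd q) (hp1 : p ≠ 1) (hp1' : p ≠ -1)
    (hq1 : q ≠ 1) (hq1' : q ≠ -1) (hpq : 0 ≤ p + q) (hr : 0 < r) :
    betaBraid p q r ∈ Submonoid.closure
      {x : BraidGroup (r.natAbs + 2) | ∃ (w : BraidGroup (r.natAbs + 2)) (i : ℕ),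
        1 ≤ i ∧ i ≤ r.natAbs + 1 ∧ x = w * braidGen (r.natAbs + 2) i * w⁻¹} := by
  obtain ⟨m, hm⟩ : ∃ m : ℕ, p + q = m := ⟨(p + q).toNat, by omega⟩
  have hr1 : 1 ≤ r.natAbs := by omega
  unfold betaBraid
  rw [if_pos hr]
  unfold gammaBarBraid
  generalize gammaBraid r.natAbs = g
  generalize r.natAbs = n at *
  set S := Submonoid.closure
      {x : BraidGroup (n + 2) | ∃ (w : BraidGroup (n + 2)) (i : ℕ),
        1 ≤ i ∧ i ≤ n + 1 ∧ x = w * braidGen (n + 2) i * w⁻¹} with hS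
  have hconj : ∀ (w : BraidGroup (n + 2)) (i : ℕ), 1 ≤ i → i ≤ n + 1 →
      w * braidGen (n + 2) i * w⁻¹ ∈ S := fun w i h1 h2 =>
    Submonoid.subset_closure ⟨w, i, h1, h2, rfl⟩
  have hgen : ∀ i : ℕ, 1 ≤ i → i ≤ n + 1 → braidGen (n + 2) i ∈ S := fun i h1 h2 => by
    simpa using hconj 1 i h1 h2
  have hbar : ((List.range (n - 1)).map
      (fun i => braidGen (n + 2) (i + 3))).reverse.prod ∈ S := by
    apply Submonoid.list_prod_mem
    intro x hx
    simp only [List.mem_reverse, List.mem_map, List.mem_range] at hx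
    obtain ⟨i, hi, rfl⟩ := hx
    exact hgen _ (by omega) (by omega)
  have hA := hconj (braidGen (n + 2) 1 ^ p) 2 (by omega) (by omega)
  have hB : braidGen (n + 2) 1 ^ m ∈ S :=
    Submonoid.pow_mem _ (hgen 1 (by omega) (by omega)) m
  have hC := hconj g⁻¹ 2 (by omega) (by omega)
  have key := S.mul_mem (S.mul_mem (S.mul_mem hA hB) hC) hbar
  have hq' : braidGen (n + 2) 1 ^ q =
      (braidGen (n + 2) 1 ^ p)⁻¹ * braidGen (n + 2) 1 ^ m := by
    rw [← zpow_natCast, ← hm, ← zpow_neg, ← zpow_add]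
    congr 1
    omega
  rw [hq']
  simpa only [mul_assoc, inv_inv] using key
end
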